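/- arXiv:2105.03927 — 2 statements merged into one kernel-verified Lean document; each statement's English description precedes it below -/
import Mathlib

section
/- Let $n$ be a positive integer and let $a \ge 1$ be a real number. Then $\int_{0}^{1} \frac{1-x^n}{1-x} \log^2(x+a)\, dx = H_n \log^2(a+1) - 2\log(a+1) H_n^{(2)} - 2\log(a+1) \sum_{k=1}^{n} \frac{(H_k + H_{n-k} - H_n)(-a)^k}{k} + 2\log(1+1/a) \sum_{k=1}^{n} \frac{(-a)^k H_k}{k} + \big(\log^2 a - \log^2(a+1)\big) \sum_{k=1}^{n} \frac{(-a)^k}{k} + 2 \sum_{p=0}^{n-1} \Big\{ \sum_{k=1}^{n-p} \Big( \frac{H_{p+k} - H_k}{(p+k)k} + \frac{1}{k^2(p+k)} \Big) \Big\} (-a)^p$. -/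
/-- The `n`-th harmonic number `H_n = ∑_{k=1}^n 1/k`, with `H_0 = 0`. -/
noncomputable def H (n : ℕ) : ℝ := ∑ i ∈ Finset.range n, (1 : ℝ) / (i + 1)

/-- The generalized harmonic number of order 2, `H_n^{(2)} = ∑_{k=1}^n 1/k²`. -/
noncomputable def H2 (n : ℕ) : ℝ := ∑ i ∈ Finset.range n, (1 : ℝ) / (i + 1) ^ 2

lemma geo (x b : ℝ) (N : ℕ) (h : x - b ≠ 0) :
    (x ^ N - b ^ N) / (x - b) = ∑ j ∈ Finset.range N, b ^ j * x ^ (N - 1 - j) := by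
  rw [div_eq_iff h]
  have := geom_sum₂_mul b x N
  linear_combination this

lemma derivPow (b : ℝ) (N : ℕ) (x : ℝ) (c : ℕ → ℝ) :
    HasDerivAt (fun x : ℝ => ∑ j ∈ Finset.range N, c j * (b ^ j * x ^ (N - j) / ((N : ℝ) - j)))
      (∑ j ∈ Finset.range N, c j * (b ^ j * x ^ (N - 1 - j))) x := by
  apply HasDerivAt.fun_sum
  intro j hj
  have hj := Finset.mem_range.1 hj
  have h1 : (N : ℝ) - j ≠ 0 := by
    have : (j : ℝ) < N := by exact_mod_cast hj
    linarith
  have h := (((hasDerivAt_pow (N - j) x).const_mul (b ^ j)).div_const ((N : ℝ) - j)).const_mul (c j)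
  refine h.congr_deriv ?_
  rw [Nat.cast_sub hj.le, show N - 1 - j = N - j - 1 by omega]
  field_simp

/-- antiderivative of `m x^(m-1) log (x+a)` -/
noncomputable def GA (a : ℝ) (m : ℕ) (x : ℝ) : ℝ :=
  (x ^ m - (-a) ^ m) * Real.log (x + a) -
    ∑ j ∈ Finset.range m, 1 * ((-a) ^ j * x ^ (m - j) / ((m : ℝ) - j))

lemma derivLog (a x : ℝ) (h : 0 < x + a) : HasDerivAt (fun x => Real.log (x + a)) (1 / (x + a)) x :=
  ((hasDerivAt_id x).add_const a).log h.ne'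

lemma derivGA (a : ℝ) (m : ℕ) (x : ℝ) (h : 0 < x + a) :
    HasDerivAt (GA a m) (m * x ^ (m - 1) * Real.log (x + a)) x := by
  have h1 := (((hasDerivAt_pow m x).sub_const ((-a) ^ m)).mul (derivLog a x h)).sub
    (derivPow (-a) m x (fun _ => 1))
  refine h1.congr_deriv ?_
  have := geo x (-a) m (by linarith)
  simp only [one_mul]
  rw [← this, sub_neg_eq_add]
  ring

noncomputable def FA (a : ℝ) (N : ℕ) (x : ℝ) : ℝ :=
  (x ^ N - (-a) ^ N) * Real.log (x + a) ^ 2 -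
    2 * ∑ k ∈ Finset.range N, (-a) ^ k / ((N : ℝ) - k) * GA a (N - k) x

lemma derivFA (a : ℝ) (N : ℕ) (x : ℝ) (h : 0 < x + a) :
    HasDerivAt (FA a N) (N * (x ^ (N - 1) * Real.log (x + a) ^ 2)) x := by
  have h2 : HasDerivAt (fun x => ∑ k ∈ Finset.range N, (-a) ^ k / ((N : ℝ) - k) * GA a (N - k) x)
      (∑ k ∈ Finset.range N, ((-a) ^ k * x ^ (N - 1 - k)) * Real.log (x + a)) x := by
    apply HasDerivAt.fun_sum
    intro k hk
    have hk := Finset.mem_range.1 hk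
    have h1 : (N : ℝ) - k ≠ 0 := by
      have : (k : ℝ) < N := by exact_mod_cast hk
      linarith
    refine ((derivGA a (N - k) x h).const_mul ((-a) ^ k / ((N : ℝ) - k))).congr_deriv ?_
    rw [Nat.cast_sub hk.le, show N - 1 - k = N - k - 1 by omega]
    field_simp
  have h1 := (((hasDerivAt_pow N x).sub_const ((-a) ^ N)).mul ((derivLog a x h).pow 2)).sub
    (h2.const_mul 2)
  refine h1.congr_deriv ?_
  have := geo x (-a) N (by linarith)
  rw [← Finset.sum_mul, ← this, sub_neg_eq_add]
  simp
  ring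

lemma intFA (a : ℝ) (ha : 1 ≤ a) (N : ℕ) :
    N * ∫ x in (0 : ℝ)..1, x ^ (N - 1) * Real.log (x + a) ^ 2 = FA a N 1 - FA a N 0 := by
  rw [← intervalIntegral.integral_const_mul]
  apply intervalIntegral.integral_eq_sub_of_hasDerivAt
  · intro x hx
    rw [Set.uIcc_of_le zero_le_one] at hx
    exact derivFA a N x (by linarith [hx.1])
  · apply ContinuousOn.intervalIntegrable
    intro x hx
    rw [Set.uIcc_of_le zero_le_one] at hx
    have : x + a ≠ 0 := by linarith [hx.1]
    apply ContinuousAt.continuousWithinAt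
    fun_prop (disch := assumption)

lemma H_succ (n : ℕ) : H (n + 1) = H n + 1 / (n + 1) := by
  simp [H, Finset.sum_range_succ]

lemma H2_succ (n : ℕ) : H2 (n + 1) = H2 n + 1 / (n + 1) ^ 2 := by
  simp [H2, Finset.sum_range_succ]

lemma sum_inv (N p : ℕ) (hp : p ≤ N) :
    ∑ k ∈ Finset.range p, 1 / ((N : ℝ) - k) = H N - H (N - p) := by
  induction p with
  | zero => simp
  | succ p ih =>
    rw [Finset.sum_range_succ, ih (by omega)]
    obtain ⟨q, rfl⟩ := Nat.exists_eq_add_of_le hp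
    rw [show p + 1 + q - p = q + 1 by omega, show p + 1 + q - (p + 1) = q by omega, H_succ q]
    push_cast
    rw [show (p : ℝ) + 1 + q - p = q + 1 by ring]
    ring

lemma dsum (N : ℕ) (b : ℝ) :
    ∑ k ∈ Finset.range N, b ^ k / ((N : ℝ) - k) *
      ∑ j ∈ Finset.range (N - k), b ^ j / (((N - k : ℕ) : ℝ) - j) =
    ∑ p ∈ Finset.range N, (H N - H (N - (p + 1))) / ((N : ℝ) - p) * b ^ p := by
  have h1 : ∀ k ∈ Finset.range N, b ^ k / ((N : ℝ) - k) *
      ∑ j ∈ Finset.range (N - k), b ^ j / (((N - k : ℕ) : ℝ) - j) =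
      ∑ p ∈ Finset.Ico k N, 1 / ((N : ℝ) - k) * (b ^ p / ((N : ℝ) - p)) := by
    intro k hk
    have hk := Finset.mem_range.1 hk
    rw [Finset.sum_Ico_eq_sum_range, Finset.mul_sum]
    refine Finset.sum_congr rfl fun j _ => ?_
    rw [Nat.cast_sub hk.le, pow_add]
    push_cast
    rw [show (N : ℝ) - (k + j) = N - k - j by ring]
    ring
  rw [Finset.sum_congr rfl h1]
  rw [Finset.sum_comm' (t' := Finset.range N) (s' := fun p => Finset.range (p + 1))]
  · refine Finset.sum_congr rfl fun p hp => ?_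
    have hp := Finset.mem_range.1 hp
    rw [← Finset.sum_mul, sum_inv N (p + 1) (by omega)]
    ring
  · intro k p
    simp only [Finset.mem_range, Finset.mem_Ico]
    omega

lemma FA_one (a : ℝ) (N : ℕ) :
    FA a N 1 = (1 - (-a) ^ N) * Real.log (a + 1) ^ 2
      - 2 * Real.log (a + 1) * ∑ k ∈ Finset.range N, (-a) ^ k / ((N : ℝ) - k)
      + 2 * Real.log (a + 1) * (-a) ^ N * H N
      + 2 * ∑ p ∈ Finset.range N, (H N - H (N - (p + 1))) / ((N : ℝ) - p) * (-a) ^ p := by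
  rw [← dsum]
  have hs := sum_inv N N le_rfl
  have h0 : H 0 = 0 := by simp [H]
  rw [Nat.sub_self, h0, sub_zero] at hs
  rw [← hs]
  simp only [FA, GA, one_pow, one_mul, mul_one, add_comm 1 a]
  have : ∀ k ∈ Finset.range N, (-a) ^ k / ((N : ℝ) - k) * ((1 - (-a) ^ (N - k)) * Real.log (a + 1) -
      ∑ j ∈ Finset.range (N - k), (-a) ^ j / (((N - k : ℕ) : ℝ) - j)) =
      Real.log (a + 1) * ((-a) ^ k / ((N : ℝ) - k)) - Real.log (a + 1) * (-a) ^ N * (1 / ((N : ℝ) - k))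
      - (-a) ^ k / ((N : ℝ) - k) * ∑ j ∈ Finset.range (N - k), (-a) ^ j / (((N - k : ℕ) : ℝ) - j) := by
    intro k hk
    have hk := Finset.mem_range.1 hk
    have e : (-a) ^ N = (-a) ^ k * (-a) ^ (N - k) := by rw [← pow_add]; congr 1; omega
    rw [e]
    ring
  rw [Finset.sum_congr rfl this, Finset.sum_sub_distrib, Finset.sum_sub_distrib,
    ← Finset.mul_sum, ← Finset.mul_sum]
  ring

lemma FA_zero (a : ℝ) (N : ℕ) (hN : 0 < N) :
    FA a N 0 = - (-a) ^ N * Real.log a ^ 2 + 2 * Real.log a * (-a) ^ N * H N := by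
  have hs := sum_inv N N le_rfl
  have h0 : H 0 = 0 := by simp [H]
  rw [Nat.sub_self, h0, sub_zero] at hs
  rw [← hs]
  simp only [FA, GA, zero_add]
  have : ∀ k ∈ Finset.range N, (-a) ^ k / ((N : ℝ) - k) * ((0 ^ (N - k) - (-a) ^ (N - k)) * Real.log a -
      ∑ j ∈ Finset.range (N - k), 1 * ((-a) ^ j * 0 ^ (N - k - j) / (((N - k : ℕ) : ℝ) - j))) =
      - (Real.log a * (-a) ^ N) * (1 / ((N : ℝ) - k)) := by
    intro k hk
    have hk := Finset.mem_range.1 hk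
    have e : (-a) ^ N = (-a) ^ k * (-a) ^ (N - k) := by rw [← pow_add]; congr 1; omega
    rw [Finset.sum_eq_zero, e, zero_pow (by omega)]
    · ring
    · intro j hj
      have hj := Finset.mem_range.1 hj
      rw [zero_pow (by omega)]
      simp
  rw [Finset.sum_congr rfl this, ← Finset.mul_sum, zero_pow hN.ne']
  ring

noncomputable def R (a : ℝ) (n : ℕ) : ℝ :=
      H n * Real.log (a + 1) ^ 2 - 2 * Real.log (a + 1) * H2 n -
        2 * Real.log (a + 1) *
          (∑ k ∈ Finset.Icc 1 n, (H k + H (n - k) - H n) * (-a) ^ k / (k : ℝ)) +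
        2 * Real.log (1 + 1 / a) * (∑ k ∈ Finset.Icc 1 n, (-a) ^ k * H k / (k : ℝ)) +
        (Real.log a ^ 2 - Real.log (a + 1) ^ 2) *
          (∑ k ∈ Finset.Icc 1 n, (-a) ^ k / (k : ℝ)) +
        2 * ∑ p ∈ Finset.range n,
          (∑ k ∈ Finset.Icc 1 (n - p),
              ((H (p + k) - H k) / (((p : ℝ) + (k : ℝ)) * (k : ℝ)) +
                1 / ((k : ℝ) ^ 2 * ((p : ℝ) + (k : ℝ))))) * (-a) ^ p

lemma S1 (b : ℝ) (n : ℕ) :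
    ((n : ℝ) + 1) * (∑ k ∈ Finset.Icc 1 (n + 1), (H k + H (n + 1 - k) - H (n + 1)) * b ^ k / (k : ℝ) -
      ∑ k ∈ Finset.Icc 1 n, (H k + H (n - k) - H n) * b ^ k / (k : ℝ)) =
    ∑ k ∈ Finset.range (n + 1), b ^ k / (((n + 1 : ℕ) : ℝ) - k) - 1 / (n + 1) := by
  have h0 : H 0 = 0 := by simp [H]
  rw [Finset.sum_Icc_succ_top (by omega), Nat.sub_self, h0, add_zero, sub_self, zero_mul, zero_div,
    add_zero, ← Finset.sum_sub_distrib, Finset.mul_sum, Finset.sum_range_succ']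
  have hre : ∑ k ∈ Finset.range n, b ^ (k + 1) / (((n + 1 : ℕ) : ℝ) - ((k + 1 : ℕ) : ℝ)) =
      ∑ k ∈ Finset.Icc 1 n, b ^ k / (((n + 1 : ℕ) : ℝ) - (k : ℝ)) := by
    have h2 : Finset.Icc 1 n = Finset.Ico 1 (n + 1) := by ext; simp
    rw [h2, Finset.sum_Ico_eq_sum_range]
    simp only [Nat.add_sub_cancel, add_comm 1]
  rw [hre]
  simp only [pow_zero, Nat.cast_zero, sub_zero, Nat.cast_add, Nat.cast_one, add_sub_cancel_right]
  refine Finset.sum_congr rfl fun k hk => ?_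
  have hk := Finset.mem_Icc.1 hk
  obtain ⟨q, rfl⟩ := Nat.exists_eq_add_of_le hk.2
  rw [show k + q + 1 - k = q + 1 by omega, show k + q - k = q by omega, H_succ, H_succ]
  have : (0 : ℝ) < k := by exact_mod_cast hk.1
  have h3 : (0 : ℝ) < k + q + 1 := by positivity
  push_cast
  rw [show (k : ℝ) + q + 1 - k = q + 1 by ring]
  field_simp
  ring

lemma S4 (b : ℝ) (n : ℕ) (f : ℕ → ℕ → ℝ) :
    ∑ p ∈ Finset.range (n + 1), (∑ k ∈ Finset.Icc 1 (n + 1 - p), f p k) * b ^ p =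
    ∑ p ∈ Finset.range n, (∑ k ∈ Finset.Icc 1 (n - p), f p k) * b ^ p +
      ∑ p ∈ Finset.range (n + 1), f p (n + 1 - p) * b ^ p := by
  have : ∑ p ∈ Finset.range n, (∑ k ∈ Finset.Icc 1 (n - p), f p k) * b ^ p =
    ∑ p ∈ Finset.range (n + 1), (∑ k ∈ Finset.Icc 1 (n - p), f p k) * b ^ p := by
    rw [Finset.sum_range_succ]; simp
  rw [this, ← Finset.sum_add_distrib]
  refine Finset.sum_congr rfl fun p hp => ?_
  have hp := Finset.mem_range.1 hp
  rw [show n + 1 - p = (n - p) + 1 by omega, Finset.sum_Icc_succ_top (by omega)]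
  ring

lemma S5 (b : ℝ) (n : ℕ) :
    ((n : ℝ) + 1) * ∑ p ∈ Finset.range (n + 1),
      ((H (p + (n + 1 - p)) - H (n + 1 - p)) / (((p : ℝ) + ((n + 1 - p : ℕ) : ℝ)) * ((n + 1 - p : ℕ) : ℝ)) +
       1 / (((n + 1 - p : ℕ) : ℝ) ^ 2 * ((p : ℝ) + ((n + 1 - p : ℕ) : ℝ)))) * b ^ p =
    ∑ p ∈ Finset.range (n + 1), (H (n + 1) - H (n + 1 - (p + 1))) / (((n + 1 : ℕ) : ℝ) - p) * b ^ p := by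
  rw [Finset.mul_sum]
  refine Finset.sum_congr rfl fun p hp => ?_
  have hp := Finset.mem_range.1 hp
  obtain ⟨q, rfl⟩ := Nat.exists_eq_add_of_le (Nat.lt_succ_iff.1 hp)
  rw [show p + q + 1 - p = q + 1 by omega, show p + q + 1 - (p + 1) = q by omega,
    ← add_assoc p q 1, H_succ q]
  push_cast
  rw [show (p : ℝ) + q + 1 - p = q + 1 by ring]
  have h3 : (0 : ℝ) < p + q + 1 := by positivity
  have h4 : (p : ℝ) + (q + 1) = p + q + 1 := by ring
  rw [h4]
  field_simp
  ring

lemma R_succ (a : ℝ) (ha : 1 ≤ a) (n : ℕ) :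
    R a (n + 1) = R a n + ∫ x in (0 : ℝ)..1, x ^ n * Real.log (x + a) ^ 2 := by
  have hI := intFA a ha (n + 1)
  rw [FA_one, FA_zero a (n + 1) (by omega), ← S5, Nat.add_sub_cancel] at hI
  have hl : Real.log (1 + 1 / a) = Real.log (a + 1) - Real.log a := by
    rw [← Real.log_div (by linarith) (by linarith)]
    congr 1
    field_simp
  have h1 := S1 (-a) n
  have hn : (n : ℝ) + 1 ≠ 0 := by positivity
  apply mul_left_cancel₀ hn
  rw [mul_add]
  push_cast at hI h1
  rw [hI]
  unfold R
  rw [hl, S4 (-a) n (fun p k => ((H (p + k) - H k) / (((p : ℝ) + (k : ℝ)) * (k : ℝ)) +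
                1 / ((k : ℝ) ^ 2 * ((p : ℝ) + (k : ℝ))))), H2_succ,
    Finset.sum_Icc_succ_top (f := fun k : ℕ => (-a) ^ k * H k / (k : ℝ)) (by omega),
    Finset.sum_Icc_succ_top (f := fun k : ℕ => (-a) ^ k / (k : ℝ)) (by omega)]
  have e1 : ((n : ℝ) + 1) * H (n + 1) = (n + 1) * H n + 1 := by
    rw [H_succ]; field_simp
  have e2 : ((n : ℝ) + 1) * (1 / (n + 1) ^ 2) = 1 / (n + 1) := by
    field_simp
  have e3 : ((n : ℝ) + 1) * ((-a) ^ (n + 1) * H (n + 1) / (n + 1)) = (-a) ^ (n + 1) * H (n + 1) := by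
    field_simp
  have e4 : ((n : ℝ) + 1) * ((-a) ^ (n + 1) / (n + 1)) = (-a) ^ (n + 1) := by
    field_simp
  push_cast
  linear_combination Real.log (a + 1) ^ 2 * e1 - 2 * Real.log (a + 1) * e2
    - 2 * Real.log (a + 1) * h1 + 2 * (Real.log (a + 1) - Real.log a) * e3
    + (Real.log a ^ 2 - Real.log (a + 1) ^ 2) * e4

lemma intSum (a : ℝ) (ha : 1 ≤ a) (n : ℕ) :
    ∫ x in (0 : ℝ)..1, (∑ i ∈ Finset.range n, x ^ i) * Real.log (x + a) ^ 2 = R a n := by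
  have hR : ∀ n, R a n = ∑ i ∈ Finset.range n, ∫ x in (0 : ℝ)..1, x ^ i * Real.log (x + a) ^ 2 := by
    intro n
    induction n with
    | zero => simp [R, H, H2]
    | succ n ih => rw [R_succ a ha, ih, Finset.sum_range_succ]
  rw [hR, ← intervalIntegral.integral_finsetSum]
  · simp only [Finset.sum_mul]
  · intro i _
    apply ContinuousOn.intervalIntegrable
    intro x hx
    rw [Set.uIcc_of_le zero_le_one] at hx
    have : x + a ≠ 0 := by linarith [hx.1]
    apply ContinuousAt.continuousWithinAt
    fun_prop (disch := assumption)

/-- For `n` a positive integer and real `a ≥ 1`,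
`∫₀¹ (1-xⁿ)/(1-x) log²(x+a) dx = H_n log²(a+1) - 2 log(a+1) H_n^{(2)}
  - 2 log(a+1) ∑_{k=1}^n (H_k+H_{n-k}-H_n)(-a)^k/k
  + 2 log(1+1/a) ∑_{k=1}^n (-a)^k H_k/k
  + (log²a - log²(a+1)) ∑_{k=1}^n (-a)^k/k
  + 2 ∑_{p=0}^{n-1} { ∑_{k=1}^{n-p} ( (H_{p+k}-H_k)/((p+k)k) + 1/(k²(p+k)) ) } (-a)^p`. -/
theorem integral_log_sq_add (n : ℕ) (hn : 0 < n) (a : ℝ) (ha : 1 ≤ a) :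
    ∫ x in (0 : ℝ)..1, (1 - x ^ n) / (1 - x) * Real.log (x + a) ^ 2 =
      H n * Real.log (a + 1) ^ 2 - 2 * Real.log (a + 1) * H2 n -
        2 * Real.log (a + 1) *
          (∑ k ∈ Finset.Icc 1 n, (H k + H (n - k) - H n) * (-a) ^ k / (k : ℝ)) +
        2 * Real.log (1 + 1 / a) * (∑ k ∈ Finset.Icc 1 n, (-a) ^ k * H k / (k : ℝ)) +
        (Real.log a ^ 2 - Real.log (a + 1) ^ 2) *
          (∑ k ∈ Finset.Icc 1 n, (-a) ^ k / (k : ℝ)) +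
        2 * ∑ p ∈ Finset.range n,
          (∑ k ∈ Finset.Icc 1 (n - p),
              ((H (p + k) - H k) / (((p : ℝ) + (k : ℝ)) * (k : ℝ)) +
                1 / ((k : ℝ) ^ 2 * ((p : ℝ) + (k : ℝ))))) * (-a) ^ p := by
  have h := intSum a ha n
  rw [R] at h
  rw [← h]
  apply intervalIntegral.integral_congr_ae
  have h1 : ∀ᵐ x : ℝ, x ≠ 1 := by
    simp [MeasureTheory.ae_iff]
  filter_upwards [h1] with x hx _
  have h2 : 1 - x ≠ 0 := sub_ne_zero.2 hx.symm
  congr 1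
  rw [div_eq_iff h2]
  linear_combination geom_sum_mul x n
end

section
/- Let $n$ be a positive integer and let $t$ be a real number with $0 < t \le 1$. Then $\sum_{k=1}^{\infty} \frac{(-t)^k H_{k-1}}{k \binom{n+k}{k}} = \frac{1}{2}\log^2(t+1) + \frac{t}{t+1} \sum_{k=1}^{n} \frac{H_k}{k}\Big(\frac{t+1}{t}\Big)^k - \frac{t\log(t+1)}{t+1} \sum_{k=1}^{n} \frac{1}{k}\Big(\frac{t+1}{t}\Big)^k + \frac{\log^2(t+1)}{2(t+1)} \sum_{k=1}^{n} \Big(\frac{t+1}{t}\Big)^k + \frac{1}{t+1} \sum_{p=0}^{n-1} \Big\{ \sum_{k=1}^{n-p} \Big( \frac{H_{p+k} - H_k}{(p+k)k} + \frac{1}{k^2(p+k)} \Big) \Big\} p \Big(\frac{t+1}{t}\Big)^p - \frac{\log(t+1)}{t+1} \sum_{k=1}^{n} H_k \Big(\frac{t+1}{t}\Big)^k$. -/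
lemma ahb_H_zero : H 0 = 0 := by simp [H]

lemma ahb_H_succ (n : ℕ) : H (n + 1) = H n + 1 / ((n : ℝ) + 1) := by
  simp [H, Finset.sum_range_succ]

lemma ahb_H_nonneg (n : ℕ) : 0 ≤ H n := by
  unfold H; positivity

lemma ahb_H_le (n : ℕ) : H n ≤ n := by
  induction n with
  | zero => simp [H]
  | succ n ih =>
    rw [ahb_H_succ]
    have h : 1 / ((n : ℝ) + 1) ≤ 1 := by
      rw [div_le_one (by positivity)]
      have : (0 : ℝ) ≤ n := by positivity
      linarith
    push_cast
    linarith

/-- The Beta-function weights. -/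
noncomputable def ahbB (n k : ℕ) : ℝ :=
  1 / (((k : ℝ) + 1) * (Nat.choose (n + (k + 1)) (k + 1) : ℝ))

lemma ahbB_eq (n k : ℕ) :
    ahbB n k = (k.factorial : ℝ) * n.factorial / (n + k + 1).factorial := by
  have h := Nat.add_choose_mul_factorial_mul_factorial n (k + 1)
  have h2 : (Nat.choose (n + (k + 1)) (k + 1) : ℝ) * n.factorial * (((k : ℝ) + 1) * k.factorial)
      = (n + k + 1).factorial := by
    rw [← Nat.choose_symm_add, Nat.factorial_succ k] at *
    rw [← add_assoc] at *
    exact_mod_cast h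
  have hc : (0 : ℝ) < (Nat.choose (n + (k + 1)) (k + 1) : ℝ) := by
    exact_mod_cast Nat.choose_pos (by omega)
  have hn : (0 : ℝ) < n.factorial := by positivity
  have hk : (0 : ℝ) < k.factorial := by positivity
  unfold ahbB
  rw [← h2]
  field_simp

lemma ahbB_zero_left (k : ℕ) : ahbB 0 k = 1 / ((k : ℝ) + 1) := by
  simp [ahbB]

lemma ahbB_zero_right (m : ℕ) : ahbB m 0 = 1 / ((m : ℝ) + 1) := by
  simp [ahbB]

lemma ahbB_sub (n k : ℕ) : ahbB n k - ahbB (n + 1) k = ahbB n (k + 1) := by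
  rw [ahbB_eq, ahbB_eq, ahbB_eq]
  have e1 : n + 1 + k + 1 = (n + k + 1) + 1 := by ring
  have e2 : n + (k + 1) + 1 = (n + k + 1) + 1 := by ring
  rw [e1, e2, Nat.factorial_succ (n + k + 1), Nat.factorial_succ n, Nat.factorial_succ k]
  have : (0 : ℝ) < (n + k + 1).factorial := by positivity
  push_cast
  field_simp
  ring

lemma ahbB_div (n k : ℕ) :
    ahbB n (k + 1) / ((k : ℝ) + 1) = ahbB (n + 1) k / ((n : ℝ) + 1) := by
  rw [ahbB_eq, ahbB_eq]
  have e1 : n + 1 + k + 1 = (n + k + 1) + 1 := by ring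
  have e2 : n + (k + 1) + 1 = (n + k + 1) + 1 := by ring
  rw [e1, e2, Nat.factorial_succ n, Nat.factorial_succ k]
  have : (0 : ℝ) < (n + k + 1 + 1).factorial := by positivity
  push_cast
  field_simp

lemma ahbB_nonneg (n k : ℕ) : 0 ≤ ahbB n k := by unfold ahbB; positivity

lemma ahbB_le (n k : ℕ) : ahbB n k ≤ 1 / ((k : ℝ) + 1) := by
  have hc : (1 : ℝ) ≤ (Nat.choose (n + (k + 1)) (k + 1) : ℝ) := by
    exact_mod_cast Nat.choose_pos (by omega)
  unfold ahbB
  apply one_div_le_one_div_of_le (by positivity)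
  nlinarith [(by positivity : (0 : ℝ) ≤ k)]

lemma ahbB_le' (n k : ℕ) (hn : 0 < n) : ahbB n k ≤ 1 / (((k : ℝ) + 1) * ((k : ℝ) + 2)) := by
  have hc : ((k : ℝ) + 2) ≤ (Nat.choose (n + (k + 1)) (k + 1) : ℝ) := by
    have h1 : Nat.choose (k + 1 + 1) (k + 1) ≤ Nat.choose (n + (k + 1)) (k + 1) :=
      Nat.choose_le_choose _ (by omega)
    rw [Nat.choose_succ_self_right] at h1
    have h2 : ((k + 1 + 1 : ℕ) : ℝ) ≤ (Nat.choose (n + (k + 1)) (k + 1) : ℝ) := by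
      exact_mod_cast h1
    push_cast at h2
    linarith
  unfold ahbB
  apply one_div_le_one_div_of_le (by positivity)
  gcongr

lemma ahb_summable_geom {t : ℝ} (ht0 : 0 < t) (ht1 : t < 1) (c : ℕ → ℝ)
    (hc : ∀ k, |c k| ≤ 1) : Summable fun k : ℕ => (-t) ^ (k + 1) * c k := by
  have hg : Summable fun k : ℕ => t ^ (k + 1) :=
    (summable_nat_add_iff 1).2 (summable_geometric_of_lt_one ht0.le ht1)
  refine Summable.of_norm_bounded hg fun k => ?_
  rw [norm_mul, norm_pow, norm_neg, Real.norm_of_nonneg ht0.le, Real.norm_eq_abs]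
  exact mul_le_of_le_one_right (by positivity) (hc k)

lemma ahb_summable_K {t : ℝ} (ht0 : 0 < t) (ht1 : t < 1) (n : ℕ) :
    Summable fun k : ℕ => (-t) ^ (k + 1) * ahbB n k := by
  apply ahb_summable_geom ht0 ht1
  intro k
  rw [abs_of_nonneg (ahbB_nonneg n k)]
  refine (ahbB_le n k).trans ?_
  rw [div_le_one (by positivity)]
  linarith [(by positivity : (0 : ℝ) ≤ k)]

lemma ahb_summable_S {t : ℝ} (ht0 : 0 < t) (ht1 : t < 1) (n : ℕ) :
    Summable fun k : ℕ => (-t) ^ (k + 1) * (H k * ahbB n k) := by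
  apply ahb_summable_geom ht0 ht1
  intro k
  rw [abs_of_nonneg (mul_nonneg (ahb_H_nonneg k) (ahbB_nonneg n k))]
  have h1 : H k * ahbB n k ≤ k * (1 / ((k : ℝ) + 1)) :=
    mul_le_mul (ahb_H_le k) (ahbB_le n k) (ahbB_nonneg n k) (by positivity)
  refine h1.trans ?_
  rw [mul_one_div, div_le_one (by positivity)]
  linarith

/-- `-∫ (1-x)^n t/(1+tx)`. -/
noncomputable def ahbK (t : ℝ) (n : ℕ) : ℝ := ∑' k : ℕ, (-t) ^ (k + 1) * ahbB n k

noncomputable def ahbS (t : ℝ) (n : ℕ) : ℝ := ∑' k : ℕ, (-t) ^ (k + 1) * (H k * ahbB n k)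

lemma ahbK_rec {t : ℝ} (ht0 : 0 < t) (ht1 : t < 1) (n : ℕ) :
    t * ahbK t (n + 1) = (1 + t) * ahbK t n + t / ((n : ℝ) + 1) := by
  have h0 := (ahb_summable_K ht0 ht1 n)
  have h1 := (ahb_summable_K ht0 ht1 (n + 1))
  have e : ahbK t n = (-t) * ahbB n 0 + ∑' k : ℕ, (-t) ^ (k + 1 + 1) * ahbB n (k + 1) := by
    unfold ahbK
    rw [h0.tsum_eq_zero_add]; simp
  have e2 : ∑' k : ℕ, (-t) ^ (k + 1 + 1) * ahbB n (k + 1) = (-t) * (ahbK t n - ahbK t (n + 1)) := by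
    unfold ahbK
    rw [← h0.tsum_sub h1, ← tsum_mul_left]
    refine tsum_congr fun k => ?_
    rw [← ahbB_sub]; ring
  rw [e2, ahbB_zero_right] at e
  have : t / ((n : ℝ) + 1) = t * (1 / ((n : ℝ) + 1)) := by ring
  rw [this]
  linarith

lemma ahbS_rec {t : ℝ} (ht0 : 0 < t) (ht1 : t < 1) (n : ℕ) :
    t * ahbS t (n + 1) = (1 + t) * ahbS t n + t * ahbK t (n + 1) / ((n : ℝ) + 1) := by
  have h0 := (ahb_summable_S ht0 ht1 n)
  have h1 := (ahb_summable_S ht0 ht1 (n + 1))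
  have hK := (ahb_summable_K ht0 ht1 (n + 1))
  have e : ahbS t n = ∑' k : ℕ, (-t) ^ (k + 1 + 1) * (H (k + 1) * ahbB n (k + 1)) := by
    unfold ahbS
    rw [h0.tsum_eq_zero_add]; simp [ahb_H_zero]
  have e2 : ∑' k : ℕ, (-t) ^ (k + 1 + 1) * (H (k + 1) * ahbB n (k + 1))
      = (-t) * (ahbS t n - ahbS t (n + 1)) + (-t / ((n : ℝ) + 1)) * ahbK t (n + 1) := by
    unfold ahbS ahbK
    rw [← h0.tsum_sub h1, ← tsum_mul_left, ← tsum_mul_left,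
      ← ((h0.sub h1).mul_left _).tsum_add (hK.mul_left _)]
    refine tsum_congr fun k => ?_
    have hd := ahbB_div n k
    have hs := ahbB_sub n k
    rw [ahb_H_succ]
    have : (-t) ^ (k + 1 + 1) * ((H k + 1 / ((k : ℝ) + 1)) * ahbB n (k + 1))
      = (-t) ^ (k + 1 + 1) * (H k * ahbB n (k + 1) + ahbB n (k + 1) / ((k : ℝ) + 1)) := by ring
    rw [this, hd, ← hs]
    ring
  rw [e2] at e
  have : t * ahbK t (n + 1) / ((n : ℝ) + 1) = - ((-t / ((n : ℝ) + 1)) * ahbK t (n + 1)) := by ring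
  rw [this]
  linarith

lemma ahbK_zero_hasSum {t : ℝ} (ht0 : 0 < t) (ht1 : t < 1) :
    HasSum (fun k : ℕ => (-t) ^ (k + 1) / ((k : ℝ) + 1)) (-Real.log (1 + t)) := by
  have h := Real.hasSum_pow_div_log_of_abs_lt_one (x := -t) (by
    rw [abs_neg, abs_of_pos ht0]; exact ht1)
  simpa using h

lemma ahbK_zero {t : ℝ} (ht0 : 0 < t) (ht1 : t < 1) : ahbK t 0 = -Real.log (1 + t) := by
  rw [← (ahbK_zero_hasSum ht0 ht1).tsum_eq]
  unfold ahbK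
  refine tsum_congr fun k => ?_
  rw [ahbB_zero_left]; ring

lemma ahb_antidiag (k : ℕ) :
    ∑ p ∈ Finset.HasAntidiagonal.antidiagonal k, (1 / ((p.1 : ℝ) + 1)) * (1 / ((p.2 : ℝ) + 1))
      = 2 * H (k + 1) / ((k : ℝ) + 2) := by
  have h1 : ∀ p ∈ Finset.HasAntidiagonal.antidiagonal k, (1 / ((p.1 : ℝ) + 1)) * (1 / ((p.2 : ℝ) + 1))
      = (1 / ((k : ℝ) + 2)) * (1 / ((p.1 : ℝ) + 1) + 1 / ((p.2 : ℝ) + 1)) := by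
    intro p hp
    have hp' : (p.1 : ℝ) + p.2 = k := by
      exact_mod_cast Finset.HasAntidiagonal.mem_antidiagonal.1 hp
    rw [← hp']
    field_simp
    ring
  rw [Finset.sum_congr rfl h1, ← Finset.mul_sum, Finset.sum_add_distrib]
  have h2 : ∑ p ∈ Finset.HasAntidiagonal.antidiagonal k, 1 / ((p.1 : ℝ) + 1) = H (k + 1) := by
    rw [Finset.Nat.sum_antidiagonal_eq_sum_range_succ_mk]
    simp [H]
  have h3 : ∑ p ∈ Finset.HasAntidiagonal.antidiagonal k, 1 / ((p.2 : ℝ) + 1) = H (k + 1) := by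
    rw [← h2, ← Finset.Nat.sum_antidiagonal_swap]
    simp
  rw [h2, h3]
  ring

lemma ahbS_zero {t : ℝ} (ht0 : 0 < t) (ht1 : t < 1) :
    ahbS t 0 = Real.log (1 + t) ^ 2 / 2 := by
  have hh := ahbK_zero_hasSum ht0 ht1
  have hn : Summable fun k : ℕ => ‖(-t) ^ (k + 1) / ((k : ℝ) + 1)‖ := hh.summable.abs
  have hp := tsum_mul_tsum_eq_tsum_sum_antidiagonal_of_summable_norm hn hn
  rw [hh.tsum_eq] at hp
  have e : ahbS t 0 = ∑' k : ℕ, (-t) ^ (k + 1 + 1) * (H (k + 1) * ahbB 0 (k + 1)) := by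
    unfold ahbS
    rw [(ahb_summable_S ht0 ht1 0).tsum_eq_zero_add]; simp [ahb_H_zero]
  have e2 : 2 * ahbS t 0 = Real.log (1 + t) ^ 2 := by
    rw [e, ← tsum_mul_left]
    have : Real.log (1 + t) ^ 2 = -Real.log (1 + t) * -Real.log (1 + t) := by ring
    rw [this, hp]
    refine tsum_congr fun k => ?_
    have h1 : ∀ p ∈ Finset.HasAntidiagonal.antidiagonal k,
        (-t) ^ (p.1 + 1) / ((p.1 : ℝ) + 1) * ((-t) ^ (p.2 + 1) / ((p.2 : ℝ) + 1))
        = (-t) ^ (k + 1 + 1) * ((1 / ((p.1 : ℝ) + 1)) * (1 / ((p.2 : ℝ) + 1))) := by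
      intro p hp
      rw [← Finset.HasAntidiagonal.mem_antidiagonal.1 hp]
      ring
    rw [Finset.sum_congr rfl h1, ← Finset.mul_sum, ahb_antidiag, ahbB_zero_left]
    push_cast
    have h2 : (k : ℝ) + 1 + 1 = k + 2 := by ring
    rw [h2]
    ring
  linarith

lemma ahbK_closed {t : ℝ} (ht0 : 0 < t) (ht1 : t < 1) (n : ℕ) :
    ahbK t n = -(((t + 1) / t) ^ n * Real.log (t + 1))
      + ∑ j ∈ Finset.range n, ((t + 1) / t) ^ (n - 1 - j) / ((j : ℝ) + 1) := by
  induction n with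
  | zero => rw [ahbK_zero ht0 ht1]; simp [add_comm]
  | succ n ih =>
    have h := ahbK_rec ht0 ht1 n
    have h' : ahbK t (n + 1) = ((t + 1) / t) * ahbK t n + 1 / ((n : ℝ) + 1) := by
      field_simp
      field_simp at h
      linarith
    rw [h', ih, Finset.sum_range_succ, mul_add, Finset.mul_sum]
    have : ∀ j ∈ Finset.range n, (t + 1) / t * (((t + 1) / t) ^ (n - 1 - j) / ((j : ℝ) + 1))
        = ((t + 1) / t) ^ (n + 1 - 1 - j) / ((j : ℝ) + 1) := by
      intro j hj
      have hj := Finset.mem_range.1 hj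
      have e : n + 1 - 1 - j = (n - 1 - j) + 1 := by omega
      rw [e]; ring
    rw [Finset.sum_congr rfl this]
    simp
    ring

/-- Closed form. -/
noncomputable def ahbC (t : ℝ) (n : ℕ) : ℝ :=
  ((t + 1) / t) ^ n * (Real.log (t + 1) ^ 2 / 2 - H n * Real.log (t + 1))
    + ∑ j ∈ Finset.range n, ((t + 1) / t) ^ (n - 1 - j) * ((H n - H j) / ((j : ℝ) + 1))

lemma ahbS_closed {t : ℝ} (ht0 : 0 < t) (ht1 : t < 1) (n : ℕ) : ahbS t n = ahbC t n := by
  induction n with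
  | zero => rw [ahbS_zero ht0 ht1]; simp [ahbC, add_comm, ahb_H_zero]
  | succ n ih =>
    have h := ahbS_rec ht0 ht1 n
    have h' : ahbS t (n + 1) = ((t + 1) / t) * ahbS t n + ahbK t (n + 1) / ((n : ℝ) + 1) := by
      field_simp
      field_simp at h
      linarith
    rw [h', ih, ahbK_closed ht0 ht1]
    unfold ahbC
    have e3 : ∀ j ∈ Finset.range (n + 1),
        ((t + 1) / t) ^ (n + 1 - 1 - j) * ((H (n + 1) - H j) / ((j : ℝ) + 1))
        = ((t + 1) / t) ^ (n - j) * ((H n - H j) / ((j : ℝ) + 1))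
          + (((t + 1) / t) ^ (n + 1 - 1 - j) / ((j : ℝ) + 1)) / ((n : ℝ) + 1) := by
      intro j hj
      rw [ahb_H_succ]
      simp only [Nat.add_sub_cancel]
      ring
    rw [Finset.sum_congr rfl e3, Finset.sum_add_distrib, ← Finset.sum_div]
    have e4 : ∑ j ∈ Finset.range (n + 1), ((t + 1) / t) ^ (n - j) * ((H n - H j) / ((j : ℝ) + 1))
        = ((t + 1) / t) *
          ∑ j ∈ Finset.range n, ((t + 1) / t) ^ (n - 1 - j) * ((H n - H j) / ((j : ℝ) + 1)) := by
      rw [Finset.sum_range_succ, Finset.mul_sum]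
      simp only [sub_self, zero_div, mul_zero, add_zero]
      refine Finset.sum_congr rfl fun j hj => ?_
      have hj := Finset.mem_range.1 hj
      have e : n - j = (n - 1 - j) + 1 := by omega
      rw [e]; ring
    rw [e4, ahb_H_succ]
    ring

lemma ahb_major : Summable fun k : ℕ => H k * (1 / (((k : ℝ) + 1) * ((k : ℝ) + 2))) := by
  have hs : ∀ N : ℕ, ∑ k ∈ Finset.range N, H k * (1 / (((k : ℝ) + 1) * ((k : ℝ) + 2)))
      = 1 - (H N + 1) / ((N : ℝ) + 1) := by
    intro N
    induction N with
    | zero => simp [ahb_H_zero]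
    | succ N ih =>
      rw [Finset.sum_range_succ, ih, ahb_H_succ]
      push_cast
      have h2 : (N : ℝ) + 1 + 1 = N + 2 := by ring
      rw [h2]
      field_simp
      ring
  refine summable_of_sum_range_le (c := 1) (fun k => ?_) fun N => ?_
  · have := ahb_H_nonneg k
    positivity
  · rw [hs]
    have := ahb_H_nonneg N
    have : 0 ≤ (H N + 1) / ((N : ℝ) + 1) := by positivity
    linarith

lemma ahbS_cont (n : ℕ) (hn : 0 < n) : ContinuousOn (fun t => ahbS t n) (Set.Icc 0 1) := by
  unfold ahbS
  refine continuousOn_tsum (fun k => by fun_prop) ahb_major fun k t ht => ?_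
  rw [norm_mul, norm_pow, norm_neg, Real.norm_of_nonneg ht.1, Real.norm_of_nonneg
    (mul_nonneg (ahb_H_nonneg k) (ahbB_nonneg n k))]
  have h1 : H k * ahbB n k ≤ H k * (1 / (((k : ℝ) + 1) * ((k : ℝ) + 2))) :=
    mul_le_mul_of_nonneg_left (ahbB_le' n k hn) (ahb_H_nonneg k)
  refine le_trans ?_ h1
  exact mul_le_of_le_one_left (mul_nonneg (ahb_H_nonneg k) (ahbB_nonneg n k))
    (pow_le_one₀ ht.1 ht.2)

lemma ahbS_eq {t : ℝ} (ht0 : 0 < t) (ht1 : t ≤ 1) (n : ℕ) (hn : 0 < n) :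
    ahbS t n = ahbC t n := by
  rcases ht1.lt_or_eq with h | rfl
  · exact ahbS_closed ht0 h n
  · have hc1 : Filter.Tendsto (fun t => ahbS t n) (nhdsWithin 1 (Set.Ioo 0 1)) (nhds (ahbS 1 n)) :=
      ((ahbS_cont n hn) 1 (by simp)).mono Set.Ioo_subset_Icc_self
    have hcC : ContinuousAt (fun t => ahbC t n) 1 := by
      unfold ahbC
      have hr : ContinuousAt (fun t : ℝ => (t + 1) / t) 1 :=
        ContinuousAt.div (by fun_prop) (by fun_prop) (by norm_num)
      have hl : ContinuousAt (fun t : ℝ => Real.log (t + 1)) 1 :=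
        ContinuousAt.log (by fun_prop) (by norm_num)
      fun_prop
    have hc2 : Filter.Tendsto (fun t => ahbC t n) (nhdsWithin 1 (Set.Ioo 0 1)) (nhds (ahbC 1 n)) :=
      hcC.tendsto.mono_left nhdsWithin_le_nhds
    have hne : (nhdsWithin (1 : ℝ) (Set.Ioo 0 1)).NeBot := by
      rw [← mem_closure_iff_nhdsWithin_neBot, closure_Ioo (by norm_num)]
      simp
    refine tendsto_nhds_unique hc1 (hc2.congr' ?_)
    filter_upwards [self_mem_nhdsWithin] with s hs
    exact (ahbS_closed hs.1 hs.2 n).symm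

/-- The inner sum `p * {...}` with upper limit `N`. -/
noncomputable def ahbD (p N : ℕ) : ℝ :=
  ∑ k ∈ Finset.range N, (1 / ((k : ℝ) + 1) - 1 / ((p : ℝ) + k + 1)) * (H (p + k + 1) - H k)

lemma ahbD_eq (p N : ℕ) :
    (∑ k ∈ Finset.Icc 1 N,
      ((H (p + k) - H k) / (((p : ℝ) + (k : ℝ)) * (k : ℝ)) +
        1 / ((k : ℝ) ^ 2 * ((p : ℝ) + (k : ℝ))))) * (p : ℝ) = ahbD p N := by
  unfold ahbD
  rw [Finset.sum_mul, ← Finset.Ico_add_one_right_eq_Icc, Finset.sum_Ico_eq_sum_range]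
  refine Finset.sum_congr (by simp) fun k _ => ?_
  have e : p + (1 + k) = p + k + 1 := by ring
  rw [e, add_comm 1 k, ahb_H_succ k]
  push_cast
  have h1 : (p : ℝ) + (k + 1) ≠ 0 := by positivity
  have h2 : (p : ℝ) + k + 1 ≠ 0 := by positivity
  field_simp
  ring

lemma ahbD_step (p N : ℕ) :
    ahbD (p + 1) N - ahbD p (N + 1)
      = H (p + 1) / ((p : ℝ) + 1) - (H (p + N + 1) - H N) / ((N : ℝ) + 1) := by
  induction N with
  | zero =>
    simp [ahbD, ahb_H_zero]
    field_simp
    ring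
  | succ N ih =>
    have h1 : ahbD (p + 1) (N + 1) = ahbD (p + 1) N
        + (1 / ((N : ℝ) + 1) - 1 / ((p : ℝ) + 1 + N + 1)) * (H (p + N + 1 + 1) - H N) := by
      unfold ahbD
      rw [Finset.sum_range_succ]
      have e : p + 1 + N + 1 = p + N + 1 + 1 := by ring
      rw [e]; push_cast; ring
    have h2 : ahbD p (N + 1 + 1) = ahbD p (N + 1)
        + (1 / ((N : ℝ) + 1 + 1) - 1 / ((p : ℝ) + (N + 1) + 1))
          * (H (p + N + 1 + 1) - H (N + 1)) := by
      unfold ahbD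
      rw [Finset.sum_range_succ]
      have e : p + (N + 1) + 1 = p + N + 1 + 1 := by ring
      rw [e]; push_cast; ring
    have h3 : ahbD (p + 1) N = ahbD p (N + 1) + (H (p + 1) / ((p : ℝ) + 1)
        - (H (p + N + 1) - H N) / ((N : ℝ) + 1)) := by linarith
    have e : p + (N + 1) + 1 = p + N + 1 + 1 := by ring
    rw [h1, h2, h3, e, ahb_H_succ (p + N + 1), ahb_H_succ N]
    push_cast
    have n1 : (p : ℝ) + 1 + N + 1 ≠ 0 := by positivity
    have n2 : (p : ℝ) + (N + 1) + 1 ≠ 0 := by positivity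
    have n3 : (p : ℝ) + N + 1 + 1 ≠ 0 := by positivity
    have n4 : (N : ℝ) + 1 + 1 ≠ 0 := by positivity
    have n5 : (N : ℝ) + 1 ≠ 0 := by positivity
    generalize H (p + N + 1) = A
    generalize H (p + 1) = B
    generalize H N = C
    generalize ahbD p (N + 1) = D
    field_simp
    ring

lemma ahb_geom (r : ℝ) (hr : r ≠ 0) (n : ℕ) :
    1 + (r - 1) / r * (∑ k ∈ Finset.Icc 1 n, r ^ k) = r ^ n := by
  induction n with
  | zero => simp
  | succ n ih =>
    rw [Finset.sum_Icc_succ_top (by omega), mul_add, ← add_assoc, ih]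
    field_simp
    ring

lemma ahb_lin (r : ℝ) (hr : r ≠ 0) (n : ℕ) :
    1 / r * (∑ k ∈ Finset.Icc 1 n, 1 / (k : ℝ) * r ^ k)
      + (r - 1) / r * (∑ k ∈ Finset.Icc 1 n, H k * r ^ k) = H n * r ^ n := by
  induction n with
  | zero => simp [ahb_H_zero]
  | succ n ih =>
    rw [Finset.sum_Icc_succ_top (by omega), Finset.sum_Icc_succ_top (by omega)]
    have : ∀ a b c d : ℝ, 1 / r * (a + b) + (r - 1) / r * (c + d)
      = (1 / r * a + (r - 1) / r * c) + (1 / r * b + (r - 1) / r * d) := by intros; ring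
    rw [this, ih, ahb_H_succ]
    push_cast
    field_simp
    ring

lemma ahb_rat (r : ℝ) (hr : r ≠ 0) (n : ℕ) :
    1 / r * (∑ k ∈ Finset.Icc 1 n, H k / (k : ℝ) * r ^ k)
      + (r - 1) / r * (∑ p ∈ Finset.range n, ahbD p (n - p) * r ^ p)
      = ∑ j ∈ Finset.range n, r ^ (n - 1 - j) * ((H n - H j) / ((j : ℝ) + 1)) := by
  rw [← Finset.sum_range_reflect (fun j => r ^ (n - 1 - j) * ((H n - H j) / ((j : ℝ) + 1)))]
  have h1 : ∀ p ∈ Finset.range n,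
      r ^ (n - 1 - (n - 1 - p)) * ((H n - H (n - 1 - p)) / (((n - 1 - p : ℕ) : ℝ) + 1))
      = H (p + 1) / ((p : ℝ) + 1) * r ^ p + ahbD p (n - p) * r ^ p
        - 1 / r * (ahbD (p + 1) (n - (p + 1)) * r ^ (p + 1)) := by
    intro p hp
    have hp := Finset.mem_range.1 hp
    obtain ⟨N, rfl⟩ : ∃ N, n = p + N + 1 := ⟨n - p - 1, by omega⟩
    have e1 : p + N + 1 - 1 - p = N := by omega
    have e2 : p + N + 1 - 1 - N = p := by omega
    have e3 : p + N + 1 - p = N + 1 := by omega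
    have e4 : p + N + 1 - (p + 1) = N := by omega
    rw [e1, e2, e3, e4]
    have hs := ahbD_step p N
    have hs' : (H (p + N + 1) - H N) / ((N : ℝ) + 1)
      = H (p + 1) / ((p : ℝ) + 1) + ahbD p (N + 1) - ahbD (p + 1) N := by linarith
    rw [hs']
    field_simp
    try ring
  rw [Finset.sum_congr rfl h1, Finset.sum_sub_distrib, Finset.sum_add_distrib, ← Finset.mul_sum]
  have h2 : ∑ p ∈ Finset.range n, ahbD (p + 1) (n - (p + 1)) * r ^ (p + 1)
      = ∑ p ∈ Finset.range n, ahbD p (n - p) * r ^ p := by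
    have a := Finset.sum_range_succ' (fun p => ahbD p (n - p) * r ^ p) n
    rw [Finset.sum_range_succ] at a
    have z : ahbD 0 (n - 0) = 0 := by simp [ahbD]
    have z2 : ahbD n (n - n) = 0 := by simp [ahbD]
    rw [z, z2] at a
    simpa using a.symm
  have h3 : 1 / r * (∑ k ∈ Finset.Icc 1 n, H k / (k : ℝ) * r ^ k)
      = ∑ p ∈ Finset.range n, H (p + 1) / ((p : ℝ) + 1) * r ^ p := by
    rw [← Finset.Ico_add_one_right_eq_Icc, Finset.sum_Ico_eq_sum_range, Finset.mul_sum]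
    refine Finset.sum_congr (by simp) fun p _ => ?_
    rw [add_comm 1 p, pow_succ]
    push_cast
    field_simp
  rw [h2, h3]
  field_simp
  ring

/-- For `n` a positive integer and real `0 < t ≤ 1`,
`∑_{k=1}^∞ (-t)^k H_{k-1}/(k C(n+k,k)) = (1/2)log²(t+1)
  + (t/(t+1)) ∑_{k=1}^n (H_k/k)((t+1)/t)^k
  - (t log(t+1)/(t+1)) ∑_{k=1}^n (1/k)((t+1)/t)^k
  + (log²(t+1)/(2(t+1))) ∑_{k=1}^n ((t+1)/t)^k
  + (1/(t+1)) ∑_{p=0}^{n-1} { ∑_{k=1}^{n-p} ( (H_{p+k}-H_k)/((p+k)k) + 1/(k²(p+k)) ) } p ((t+1)/t)^p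
  - (log(t+1)/(t+1)) ∑_{k=1}^n H_k ((t+1)/t)^k`. -/
theorem alt_harmonic_binom_series_lin (n : ℕ) (hn : 0 < n) (t : ℝ) (ht0 : 0 < t) (ht1 : t ≤ 1) :
    ∑' k : ℕ,
        (-t) ^ (k + 1) * H k / (((k : ℝ) + 1) * (Nat.choose (n + (k + 1)) (k + 1) : ℝ)) =
      1 / 2 * Real.log (t + 1) ^ 2 +
        t / (t + 1) * (∑ k ∈ Finset.Icc 1 n, H k / (k : ℝ) * ((t + 1) / t) ^ k) -
        t * Real.log (t + 1) / (t + 1) *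
          (∑ k ∈ Finset.Icc 1 n, 1 / (k : ℝ) * ((t + 1) / t) ^ k) +
        Real.log (t + 1) ^ 2 / (2 * (t + 1)) * (∑ k ∈ Finset.Icc 1 n, ((t + 1) / t) ^ k) +
        1 / (t + 1) *
          (∑ p ∈ Finset.range n,
            (∑ k ∈ Finset.Icc 1 (n - p),
                ((H (p + k) - H k) / (((p : ℝ) + (k : ℝ)) * (k : ℝ)) +
                  1 / ((k : ℝ) ^ 2 * ((p : ℝ) + (k : ℝ))))) * (p : ℝ) * ((t + 1) / t) ^ p) -
        Real.log (t + 1) / (t + 1) * ∑ k ∈ Finset.Icc 1 n, H k * ((t + 1) / t) ^ k := by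
  have hL : ∑' k : ℕ,
        (-t) ^ (k + 1) * H k / (((k : ℝ) + 1) * (Nat.choose (n + (k + 1)) (k + 1) : ℝ))
      = ahbS t n := by
    unfold ahbS ahbB
    refine tsum_congr fun k => ?_
    ring
  rw [hL, ahbS_eq ht0 ht1 n hn]
  simp only [ahbD_eq]
  have hr0 : (t + 1) / t ≠ 0 := by positivity
  have h1 := ahb_geom ((t + 1) / t) hr0 n
  have h2 := ahb_lin ((t + 1) / t) hr0 n
  have h3 := ahb_rat ((t + 1) / t) hr0 n
  unfold ahbC
  have e1 : 1 / ((t + 1) / t) = t / (t + 1) := by simp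
  have e2 : ((t + 1) / t - 1) / ((t + 1) / t) = 1 / (t + 1) := by
    field_simp
    ring
  rw [e2] at h1
  rw [e1, e2] at h2 h3
  rw [← h3]
  have : ∀ x y z : ℝ, x * (y / 2 - H n * z) = x * (y / 2) - (H n * x) * z := by intros; ring
  rw [this, ← h2, ← h1]
  have e5 : Real.log (t + 1) ^ 2 / (2 * (t + 1)) = Real.log (t + 1) ^ 2 / 2 * (1 / (t + 1)) := by
    field_simp
  rw [e5]
  ring
end
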